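/- arXiv:2203.14753 — 3 statements merged into one kernel-verified Lean document; each statement's English description precedes it below -/
import Mathlib

section
/- Optimal transmit power, saturated-budget case (Theorem 2, second case). Let T be a positive integer, and for each t ∈ {0,…,T−1} let h_t > 0 and η_t > 0 be given; let 0 < P̄ < Pmax. Define the feasible set S = { p : {0,…,T−1} → ℝ : 0 ≤ p_t ≤ Pmax for all t, and Σ_{t=0}^{T−1} p_t ≤ T·P̄ } and the objective J(p) = Σ_{t=0}^{T−1} (√(p_t)·h_t/√(η_t) − 1)². If Σ_{t=0}^{T−1} min(η_t/h_t², Pmax) > T·P̄, then there exists a multiplier μ ≥ 0 such that the power allocation p*_t := min( (√(η_t)·h_t/(h_t² + μ·η_t))², Pmax ) satisfies Σ_{t=0}^{T−1} p*_t = T·P̄, p* ∈ S, and J(p*) ≤ J(p) for every p ∈ S. -/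
open Filter Topology in
/-- The allocated power vanishes as the multiplier grows. -/
theorem tendsto_power_atTop (h η Pmax : ℝ) (hη : 0 < η) (hP : 0 ≤ Pmax) :
    Tendsto (fun μ : ℝ => min ((Real.sqrt η * h / (h ^ 2 + μ * η)) ^ 2) Pmax) atTop (𝓝 0) := by
  have hden : Tendsto (fun μ : ℝ => h ^ 2 + μ * η) atTop atTop :=
    tendsto_atTop_add_const_left _ _ (tendsto_id.atTop_mul_const hη)
  have hlim := ((hden.const_div_atTop (Real.sqrt η * h)).pow 2).min
    (tendsto_const_nhds (x := Pmax))
  simpa [hP] using hlim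

/-- The allocated power depends continuously on the multiplier. -/
theorem continuousOn_power (h η Pmax : ℝ) (hh : 0 < h) (hη : 0 < η) :
    ContinuousOn (fun μ : ℝ => min ((Real.sqrt η * h / (h ^ 2 + μ * η)) ^ 2) Pmax)
      (Set.Ici 0) := by
  have hden : ∀ μ ∈ Set.Ici (0 : ℝ), h ^ 2 + μ * η ≠ 0 := by
    intro μ hμ
    have hμ' : 0 ≤ μ := hμ
    positivity
  have hdiv : ContinuousOn (fun μ : ℝ => Real.sqrt η * h / (h ^ 2 + μ * η)) (Set.Ici 0) :=
    ContinuousOn.div (by fun_prop) (by fun_prop) hden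
  exact fun μ hμ => ((hdiv μ hμ).pow 2).min tendsto_const_nhds

/-- The allocated power minimizes the single-round Lagrangian over `[0, Pmax]`. -/
theorem lagrangian_power_le (h η Pmax μ p : ℝ) (hh : 0 < h) (hη : 0 < η) (hμ : 0 ≤ μ)
    (hp : 0 ≤ p) (hpP : p ≤ Pmax) :
    (Real.sqrt (min ((Real.sqrt η * h / (h ^ 2 + μ * η)) ^ 2) Pmax) * h / Real.sqrt η - 1) ^ 2
        + μ * min ((Real.sqrt η * h / (h ^ 2 + μ * η)) ^ 2) Pmax
      ≤ (Real.sqrt p * h / Real.sqrt η - 1) ^ 2 + μ * p := by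
  have hr : 0 < Real.sqrt η := Real.sqrt_pos.2 hη
  have hr2 : Real.sqrt η ^ 2 = η := Real.sq_sqrt hη.le
  set a := Real.sqrt η * h / (h ^ 2 + μ * η) with ha
  have ha0 : 0 ≤ a := by positivity
  have hs2 : Real.sqrt p ^ 2 = p := Real.sq_sqrt hp
  set c := h / Real.sqrt η with hc
  have hac : a * (c ^ 2 + μ) = c := by
    have hden : h ^ 2 + μ * η ≠ 0 := by positivity
    rw [ha, hc, div_pow, hr2]
    field_simp
    rw [hr2]
  have hk : 0 ≤ c ^ 2 + μ := by positivity
  have diff : ∀ s m : ℝ, (s * c - 1) ^ 2 + μ * s ^ 2 - ((m * c - 1) ^ 2 + μ * m ^ 2)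
      = (c ^ 2 + μ) * ((s - m) * (s + m - 2 * a)) := by
    intro s m
    linear_combination (2 * (s - m)) * hac
  simp only [mul_div_assoc, ← hc]
  rcases le_total (a ^ 2) Pmax with hcase | hcase
  · rw [min_eq_left hcase, Real.sqrt_sq ha0]
    have hd := diff (Real.sqrt p) a
    rw [hs2] at hd
    have : 0 ≤ (c ^ 2 + μ) * ((Real.sqrt p - a) * (Real.sqrt p + a - 2 * a)) :=
      mul_nonneg hk (by nlinarith [sq_nonneg (Real.sqrt p - a)])
    linarith
  · rw [min_eq_right hcase]
    have hd := diff (Real.sqrt p) (Real.sqrt Pmax)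
    rw [hs2, Real.sq_sqrt (hp.trans hpP)] at hd
    have hsM : Real.sqrt p ≤ Real.sqrt Pmax := Real.sqrt_le_sqrt hpP
    have hMa : Real.sqrt Pmax ≤ a := Real.sqrt_le_iff.2 ⟨ha0, hcase⟩
    have : 0 ≤ (c ^ 2 + μ) *
        ((Real.sqrt p - Real.sqrt Pmax) * (Real.sqrt p + Real.sqrt Pmax - 2 * a)) :=
      mul_nonneg hk (mul_nonneg_of_nonpos_of_nonpos (by linarith) (by linarith))
    linarith

/-- **Optimal transmit power, saturated-budget case (Theorem 2, second case).**
If `∑ t min(η t / (h t)², Pmax) > T · P̄`, then there is a multiplier `μ ≥ 0` such that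
`p* t = min((√(η t)·h t/(h t² + μ·η t))², Pmax)` exhausts the average power budget,
is feasible, and minimizes `J(p) = ∑ t (√(p t)·h t/√(η t) − 1)²` over the feasible set. -/
theorem optimal_transmit_power_saturated
    (T : ℕ) (hT : 0 < T) (h η : Fin T → ℝ) (hh : ∀ t, 0 < h t) (hη : ∀ t, 0 < η t)
    (Pbar Pmax : ℝ) (hPbar : 0 < Pbar) (hPP : Pbar < Pmax)
    (hcond : (T : ℝ) * Pbar < ∑ t, min (η t / h t ^ 2) Pmax) :
    ∃ μ : ℝ, 0 ≤ μ ∧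
      (∑ t, min ((Real.sqrt (η t) * h t / (h t ^ 2 + μ * η t)) ^ 2) Pmax = (T : ℝ) * Pbar) ∧
      ((∀ t, 0 ≤ min ((Real.sqrt (η t) * h t / (h t ^ 2 + μ * η t)) ^ 2) Pmax ∧
            min ((Real.sqrt (η t) * h t / (h t ^ 2 + μ * η t)) ^ 2) Pmax ≤ Pmax) ∧
        ∑ t, min ((Real.sqrt (η t) * h t / (h t ^ 2 + μ * η t)) ^ 2) Pmax ≤ (T : ℝ) * Pbar) ∧
      ∀ p : Fin T → ℝ,
        ((∀ t, 0 ≤ p t ∧ p t ≤ Pmax) ∧ ∑ t, p t ≤ (T : ℝ) * Pbar) →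
        (∑ t, (Real.sqrt (min ((Real.sqrt (η t) * h t / (h t ^ 2 + μ * η t)) ^ 2) Pmax)
              * h t / Real.sqrt (η t) - 1) ^ 2)
          ≤ ∑ t, (Real.sqrt (p t) * h t / Real.sqrt (η t) - 1) ^ 2 := by
  have hPmax : 0 < Pmax := hPbar.trans hPP
  have hTP : 0 < (T : ℝ) * Pbar := by positivity
  set F : ℝ → ℝ := fun μ =>
    ∑ t, min ((Real.sqrt (η t) * h t / (h t ^ 2 + μ * η t)) ^ 2) Pmax with hF
  have hcont : ContinuousOn F (Set.Ici 0) :=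
    continuousOn_finsetSum _ fun t _ => continuousOn_power (h t) (η t) Pmax (hh t) (hη t)
  have hlim : Filter.Tendsto F Filter.atTop (nhds 0) := by
    simpa using tendsto_finsetSum Finset.univ fun t _ =>
      tendsto_power_atTop (h t) (η t) Pmax (hη t) hPmax.le
  have hF0 : (T : ℝ) * Pbar ≤ F 0 := by
    refine hcond.le.trans_eq (Finset.sum_congr rfl fun t _ => ?_)
    have := (hh t).ne'
    congr 1
    rw [zero_mul, add_zero, div_pow, mul_pow, Real.sq_sqrt (hη t).le]
    field_simp
  obtain ⟨b, hb, hb0⟩ :=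
    ((hlim.eventually_lt_const hTP).and (Filter.eventually_ge_atTop 0)).exists
  obtain ⟨μ, ⟨hμ, -⟩, hFμ⟩ :=
    intermediate_value_Icc' hb0 (hcont.mono Set.Icc_subset_Ici_self) ⟨hb.le, hF0⟩
  refine ⟨μ, hμ, hFμ, ⟨fun t => ⟨le_min (sq_nonneg _) hPmax.le, min_le_right _ _⟩, hFμ.le⟩, ?_⟩
  rintro p ⟨hp, hsum⟩
  have hL := Finset.sum_le_sum fun t (_ : t ∈ Finset.univ) =>
    lagrangian_power_le (h t) (η t) Pmax μ (p t) (hh t) (hη t) hμ (hp t).1 (hp t).2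
  simp only [Finset.sum_add_distrib, ← Finset.mul_sum] at hL
  simp only [hF] at hFμ
  rw [hFμ] at hL
  linarith [mul_le_mul_of_nonneg_left hsum hμ]
end

section
/- Optimal receive normalizing factor (closed form of the solution to the per-round subproblem, equation (29)). Let K be a positive integer, σ > 0, and for each k ∈ {1,…,K} let p_k ≥ 0 and h_k > 0, with Σ_{k=1}^K √(p_k)·h_k > 0. Define ℰ(η) = Σ_{k=1}^K (√(p_k)·h_k/√η − 1)² + σ²/η for η > 0. Then η* := ( (σ² + Σ_{k=1}^K p_k·h_k²) / (Σ_{k=1}^K √(p_k)·h_k) )² satisfies ℰ(η*) ≤ ℰ(η) for every η > 0. -/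
/-- The mean squared error is a quadratic polynomial in the inverse of the amplitude scaling. -/
theorem sum_div_sub_one_sq_add_div_sq {ι : Type*} [Fintype ι] (a : ι → ℝ) (c s : ℝ) :
    (∑ k, (a k / s - 1) ^ 2) + c / s ^ 2
      = (c + ∑ k, a k ^ 2) * s⁻¹ ^ 2 - 2 * (∑ k, a k) * s⁻¹ + Fintype.card ι := by
  have expand : ∀ k, (a k / s - 1) ^ 2 = a k ^ 2 * s⁻¹ ^ 2 - a k * (2 * s⁻¹) + 1 := by
    intro k
    ring
  simp only [expand, Finset.sum_add_distrib, Finset.sum_sub_distrib, ← Finset.sum_mul,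
    Finset.sum_const, Finset.card_univ, nsmul_eq_mul]
  ring

/-- A quadratic with positive leading coefficient `A` and linear coefficient `-2 * B` is minimized
at `B / A`. -/
theorem quadratic_min_le {A : ℝ} (hA : 0 < A) (B t : ℝ) :
    A * (A / B)⁻¹ ^ 2 - 2 * B * (A / B)⁻¹ ≤ A * t ^ 2 - 2 * B * t := by
  have vertex : A * t ^ 2 - 2 * B * t
      = A * (A / B)⁻¹ ^ 2 - 2 * B * (A / B)⁻¹ + A * (t - B / A) ^ 2 := by
    rw [inv_div]
    field_simp
    ring
  rw [vertex]
  exact le_add_of_nonneg_right (by positivity)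

/-- **Optimal receive normalizing factor (equation (29)).**
With transmit powers `p k ≥ 0`, channel magnitudes `h k > 0`, noise level `σ > 0`,
and `∑ k √(p k) · h k > 0`, the normalizing factor
`η* = ((σ² + ∑ k p k · h k²) / (∑ k √(p k) · h k))²` minimizes
`ℰ(η) = ∑ k (√(p k)·h k/√η − 1)² + σ²/η` over `η > 0`. -/
theorem optimal_receive_normalizing_factor
    (K : ℕ) (hK : 0 < K) (σ : ℝ) (hσ : 0 < σ)
    (p h : Fin K → ℝ) (hp : ∀ k, 0 ≤ p k) (hh : ∀ k, 0 < h k)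
    (hsum : 0 < ∑ k, Real.sqrt (p k) * h k) :
    ∀ η : ℝ, 0 < η →
      (∑ k, (Real.sqrt (p k) * h k /
            Real.sqrt (((σ ^ 2 + ∑ k, p k * h k ^ 2) / (∑ k, Real.sqrt (p k) * h k)) ^ 2)
          - 1) ^ 2)
        + σ ^ 2 / (((σ ^ 2 + ∑ k, p k * h k ^ 2) / (∑ k, Real.sqrt (p k) * h k)) ^ 2)
      ≤ (∑ k, (Real.sqrt (p k) * h k / Real.sqrt η - 1) ^ 2) + σ ^ 2 / η := by
  intro η hη
  have sq_amplitude : ∀ k, p k * h k ^ 2 = (Real.sqrt (p k) * h k) ^ 2 := by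
    intro k
    rw [mul_pow, Real.sq_sqrt (hp k)]
  simp only [sq_amplitude]
  have hA : 0 < σ ^ 2 + ∑ k, (Real.sqrt (p k) * h k) ^ 2 := by positivity
  have noise : σ ^ 2 / η = σ ^ 2 / Real.sqrt η ^ 2 := by rw [Real.sq_sqrt hη.le]
  rw [Real.sqrt_sq (div_pos hA hsum).le, noise, sum_div_sub_one_sq_add_div_sq,
    sum_div_sub_one_sq_add_div_sq]
  gcongr ?_ + _
  exact quadratic_min_le hA _ _
end

section
/- Inner-product lower bound between the global gradient and the averaged accumulated gradients (Lemma 2). Let N, K, φ be positive integers and L ≥ 0. Let F_k : ℝ^N → ℝ (k = 1,…,K) be differentiable functions whose gradients are L-Lipschitz, and set F = (1/K)·Σ_{k=1}^K F_k. Let w ∈ ℝ^N and let w_{k,ζ} ∈ ℝ^N for k ∈ {1,…,K} and ζ ∈ {0,…,φ−1}. Then ⟨ ∇F(w), (1/K)·Σ_{k=1}^K Σ_{ζ=0}^{φ−1} ∇F_k(w_{k,ζ}) ⟩ ≥ (φ/2)·‖∇F(w)‖² + (1/2)·Σ_{ζ=0}^{φ−1} ‖ (1/K)·Σ_{k=1}^K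 ∇F_k(w_{k,ζ}) ‖² − (L²/2)·Σ_{ζ=0}^{φ−1} (1/K)·Σ_{k=1}^K ‖ w − w_{k,ζ} ‖². -/
open scoped RealInnerProductSpace
open Finset

section

variable {ι E : Type*} [NormedAddCommGroup E]

/-- Jensen's inequality for the squared norm of an average. -/
theorem norm_inv_card_smul_sum_sq_le [NormedSpace ℝ E] (s : Finset ι) (v : ι → E) :
    ‖(1 / #s : ℝ) • ∑ i ∈ s, v i‖ ^ 2 ≤ (1 / #s : ℝ) * ∑ i ∈ s, ‖v i‖ ^ 2 := by
  rcases s.eq_empty_or_nonempty with rfl | hs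
  · simp
  have hcard : (0 : ℝ) < #s := by exact_mod_cast hs.card_pos
  have hsum : ‖∑ i ∈ s, v i‖ ^ 2 ≤ #s * ∑ i ∈ s, ‖v i‖ ^ 2 :=
    (pow_le_pow_left₀ (norm_nonneg _) (norm_sum_le _ _) 2).trans sq_sum_le_card_mul_sum_sq
  rw [norm_smul, mul_pow, Real.norm_of_nonneg (by positivity)]
  calc (1 / #s : ℝ) ^ 2 * ‖∑ i ∈ s, v i‖ ^ 2
      ≤ (1 / #s : ℝ) ^ 2 * (#s * ∑ i ∈ s, ‖v i‖ ^ 2) := by gcongr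
    _ = (1 / #s : ℝ) * ∑ i ∈ s, ‖v i‖ ^ 2 := by field_simp

variable [InnerProductSpace ℝ E]

theorem HasGradientAt.const_mul_sum [CompleteSpace E] {s : Finset ι} {f : ι → E → ℝ} {g : ι → E}
    {x : E} (c : ℝ) (h : ∀ i ∈ s, HasGradientAt (f i) (g i) x) :
    HasGradientAt (fun y => c * ∑ i ∈ s, f i y) (c • ∑ i ∈ s, g i) x := by
  rw [hasGradientAt_iff_hasFDerivAt, map_smulₛₗ, map_sum]
  exact (HasFDerivAt.fun_sum fun i hi => (h i hi).hasFDerivAt).const_mul c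

theorem norm_sq_add_norm_sq_le_two_mul_inner_add {a b : E} {r : ℝ} (h : ‖a - b‖ ^ 2 ≤ r) :
    ‖a‖ ^ 2 + ‖b‖ ^ 2 ≤ 2 * ⟪a, b⟫ + r := by
  linarith [norm_sub_sq_real a b]

end

/-- **Inner-product lower bound between the global gradient and the averaged accumulated
gradients (Lemma 2).** For `L`-Lipschitz gradients `∇F_k` of the local losses and
`F = (1/K)∑ F_k`, the inner product of `∇F(w)` with the double average of local gradients
at local models `w_{k,ζ}` is bounded below as stated. -/
theorem inner_product_lower_bound_accumulated_gradients
    (N K φ : ℕ) (hN : 0 < N) (hK : 0 < K) (hφ : 0 < φ) (L : ℝ) (hL : 0 ≤ L)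
    (F : Fin K → EuclideanSpace ℝ (Fin N) → ℝ)
    (gradF : Fin K → EuclideanSpace ℝ (Fin N) → EuclideanSpace ℝ (Fin N))
    (hgrad : ∀ k x, HasGradientAt (F k) (gradF k x) x)
    (hLip : ∀ k, LipschitzWith L.toNNReal (gradF k))
    (gradGlob : EuclideanSpace ℝ (Fin N) → EuclideanSpace ℝ (Fin N))
    (hgradGlob : ∀ x, HasGradientAt (fun y => (1 / K : ℝ) * ∑ k, F k y) (gradGlob x) x)
    (w : EuclideanSpace ℝ (Fin N)) (W : Fin K → Fin φ → EuclideanSpace ℝ (Fin N)) :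
    ⟪gradGlob w, (1 / K : ℝ) • ∑ k, ∑ ζ, gradF k (W k ζ)⟫ ≥
      ((φ : ℝ) / 2) * ‖gradGlob w‖ ^ 2
        + (1 / 2) * ∑ ζ, ‖(1 / K : ℝ) • ∑ k, gradF k (W k ζ)‖ ^ 2
        - (L ^ 2 / 2) * ∑ ζ, (1 / K : ℝ) * ∑ k, ‖w - W k ζ‖ ^ 2 := by
  have hglob : gradGlob w = (1 / K : ℝ) • ∑ k, gradF k w :=
    (hgradGlob w).unique (HasGradientAt.const_mul_sum _ fun k _ => hgrad k w)
  have hdist (ζ : Fin φ) : ‖gradGlob w - (1 / K : ℝ) • ∑ k, gradF k (W k ζ)‖ ^ 2 ≤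
      L ^ 2 * ((1 / K : ℝ) * ∑ k, ‖w - W k ζ‖ ^ 2) := by
    have hjensen := norm_inv_card_smul_sum_sq_le univ fun k => gradF k w - gradF k (W k ζ)
    rw [card_univ, Fintype.card_fin] at hjensen
    rw [hglob, ← smul_sub, ← sum_sub_distrib, mul_left_comm, mul_sum]
    refine hjensen.trans ?_
    gcongr with k
    rw [← mul_pow]
    gcongr
    simpa [Real.coe_toNNReal L hL] using (hLip k).norm_sub_le w (W k ζ)
  have hsum := sum_le_sum fun ζ (_ : ζ ∈ univ) =>
    norm_sq_add_norm_sq_le_two_mul_inner_add (hdist ζ)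
  simp only [sum_add_distrib, ← mul_sum, sum_const, card_univ, Fintype.card_fin, nsmul_eq_mul,
    ← inner_sum, ← smul_sum] at hsum
  rw [sum_comm (f := fun k ζ => gradF k (W k ζ))]
  simp only [← mul_sum]
  linarith
end
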